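/- Let g be a nonnegative real-valued function on the primes satisfying ∑_{p ≤ x, p prime} g(p) log p = log x + O(1) for all x ≥ 2. Fix k ≥ 1 and let η : ℝ^k → ℂ be a continuous function with compact support contained in (0,∞)^k. Then ∑_{q_1, …, q_k prime} g(q_1) ⋯ g(q_k) · η( log q_1/log x, …, log q_k/log x ) → ∫_{(0,∞)^k} η(t_1,…,t_k)/(t_1 ⋯ t_k) dt_1⋯dt_k as x → ∞, where the sum is over all k-tuples of (not necessarily distinct) primes. -/

import Mathlib

open Finset Filter Real

open scoped Classical

/-- `N a x = ∑_{1 ≤ n ≤ x} a n`. -/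
noncomputable def N (a : ℕ → ℝ) (x : ℝ) : ℝ := ∑ n ∈ Finset.Icc 1 ⌊x⌋₊, a n

/-- `Nd a d x = ∑_{1 ≤ n ≤ x, d ∣ n} a n`. -/
noncomputable def Nd (a : ℕ → ℝ) (d : ℕ) (x : ℝ) : ℝ :=
  ∑ n ∈ (Finset.Icc 1 ⌊x⌋₊).filter (fun n => d ∣ n), a n

/-- `Ω n`: number of prime factors of `n` counted with multiplicity. -/
def bigOmega (n : ℕ) : ℕ := n.primeFactorsList.length

/-- Regularity: for each fixed `0 < c < 1`, `N(x^c) = o(N(x))` as `x → ∞`. -/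
def Regular (a : ℕ → ℝ) : Prop :=
  ∀ c : ℝ, 0 < c → c < 1 →
    (fun x : ℝ => N a (x ^ c)) =o[atTop] fun x : ℝ => N a x

/-- `g` is multiplicative: `g 1 = 1` and `g (m n) = g m * g n` for coprime `m, n`. -/
def MultOn (g : ℕ → ℝ) : Prop :=
  g 1 = 1 ∧ ∀ m n : ℕ, Nat.Coprime m n → g (m * n) = g m * g n

/-- `(a n)` has level of distribution `ϑ` with density `g`. -/
def HasLevel (a : ℕ → ℝ) (ϑ : ℝ) (g : ℕ → ℝ) : Prop :=
  MultOn g ∧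
  (∀ d : ℕ, 1 ≤ d → g d ∈ Set.Icc (0:ℝ) 1) ∧
  (∃ M : ℝ, ∀ x : ℝ, 2 ≤ x →
      |(∑ p ∈ (Finset.Icc 1 ⌊x⌋₊).filter Nat.Prime, g p * Real.log p) - Real.log x| ≤ M) ∧
  (∃ C : ℝ, 1 ≤ C ∧ ∃ K : ℝ, ∀ d : ℕ, 1 ≤ d → g d ≤ K * C ^ bigOmega d / d) ∧
  (∀ c : ℝ, 0 < c → c < ϑ → ∀ A : ℝ, 0 < A → ∃ K : ℝ, ∀ x : ℝ, 2 ≤ x →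
      ∑ d ∈ Finset.Icc 1 ⌊x ^ c⌋₊, |Nd a d x - g d * N a x| ≤ K * N a x / Real.log x ^ A)

/-- Local uniformity with explicit parameters `δ`, `B`, `C`. -/
def LocallyUniformWith (a : ℕ → ℝ) (δ B C : ℝ) : Prop :=
  ∃ K : ℝ, ∀ x : ℝ, 2 ≤ x → ∀ d : ℕ, 1 ≤ d → (d : ℝ) ≤ x ^ δ →
    Nd a d x ≤ K * Real.log x ^ B * C ^ bigOmega d * N a x / d

/-- Local uniformity: some parameters `δ > 0`, `B ≥ 0`, `C ≥ 1` work. -/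
def LocallyUniform (a : ℕ → ℝ) : Prop :=
  ∃ δ : ℝ, 0 < δ ∧ ∃ B : ℝ, 0 ≤ B ∧ ∃ C : ℝ, 1 ≤ C ∧ LocallyUniformWith a δ B C

/-- The `j`-th largest prime factor of `n` (with multiplicity), `1` if `n` has fewer
than `j` prime factors.  (Indexing: `j ≥ 1`.) -/
def nthPF (n j : ℕ) : ℕ :=
  (n.primeFactorsList.mergeSort (fun p q => decide (q ≤ p))).getD (j - 1) 1

/-- `log p / log n`, with the convention that this is `1` when `n = 1`. -/
noncomputable def logRatio (n p : ℕ) : ℝ := if n = 1 then 1 else Real.log p / Real.log n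

/-- The largest prime factor `P⁺(n)`, with `P⁺(1) = 1`. -/
def Pplus (n : ℕ) : ℕ := n.primeFactorsList.foldr max 1

/-- The number of roots of `F` modulo `d`. -/
def rootCount (F : Polynomial ℤ) (d : ℕ) : ℕ :=
  ((Finset.range d).filter (fun r : ℕ => (d:ℤ) ∣ F.eval (r:ℤ))).card

open MeasureTheory

lemma aux_riemann {Ω : Type*} [MeasurableSpace Ω] (μ : Measure Ω) [IsFiniteMeasure μ] {k : ℕ}
    (u : Ω → ℝ) (hu : Measurable u) (hpos : ∀ᵐ w ∂μ, 0 ≤ u w)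
    (F : (Fin k → ℝ) → ℂ) (hF : Continuous F) (hcs : HasCompactSupport F)
    (δ ε : ℝ) (hδ : 0 < δ) (hε : ∀ s t, dist s t ≤ δ → ‖F s - F t‖ ≤ ε)
    (S : Finset (Fin k → ℕ)) (hS : ∀ j, j ∉ S → F (fun i => δ * j i) = 0) :
    ‖(∫ q, F (fun i => u (q i)) ∂(Measure.pi fun _ : Fin k => μ)) -
      ∑ j ∈ S, ((∏ i, μ.real {w | ⌈u w / δ⌉₊ = j i} : ℝ) : ℂ) * F (fun i => δ * j i)‖
      ≤ ε * μ.real Set.univ ^ k := by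
  obtain ⟨C, hC⟩ := hcs.exists_bound_of_continuous hF
  have hr : Measurable (fun w => ⌈u w / δ⌉₊) := Nat.measurable_ceil.comp (hu.div_const δ)
  have hm1 : Measurable (fun q : Fin k → Ω => (fun i => u (q i))) := by fun_prop
  have hm2 : Measurable (fun q : Fin k → Ω => (fun i => ⌈u (q i) / δ⌉₊)) :=
    measurable_pi_lambda _ fun i => hr.comp (measurable_pi_apply i)
  have hm3 : Measurable (fun j : Fin k → ℕ => (fun i => δ * (j i : ℝ))) := by fun_prop
  have i1 : Integrable (fun q : Fin k → Ω => F (fun i => u (q i)))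
      (Measure.pi fun _ : Fin k => μ) :=
    Integrable.of_bound (hF.measurable.comp hm1).aestronglyMeasurable C
      (Eventually.of_forall fun q => hC _)
  have i2 : Integrable (fun q : Fin k → Ω => F (fun i => δ * (⌈u (q i) / δ⌉₊ : ℝ)))
      (Measure.pi fun _ : Fin k => μ) :=
    Integrable.of_bound (hF.measurable.comp (hm3.comp hm2)).aestronglyMeasurable C
      (Eventually.of_forall fun q => hC _)
  have : IsFiniteMeasure (μ.map fun w => ⌈u w / δ⌉₊) := inferInstance
  have e2 : ∫ q, F (fun i => δ * (⌈u (q i) / δ⌉₊ : ℝ)) ∂(Measure.pi fun _ : Fin k => μ) =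
      ∑ j ∈ S, ((∏ i, μ.real {w | ⌈u w / δ⌉₊ = j i} : ℝ) : ℂ) * F (fun i => δ * j i) := by
    have hmap := Measure.pi_map_pi (μ := fun _ : Fin k => μ)
      (f := fun _ w => ⌈u w / δ⌉₊) (fun _ => hr.aemeasurable)
    have h1 : ∫ q, F (fun i => δ * (⌈u (q i) / δ⌉₊ : ℝ)) ∂(Measure.pi fun _ : Fin k => μ) =
      ∫ j, F (fun i => δ * (j i : ℝ)) ∂(Measure.pi fun _ : Fin k => μ.map fun w => ⌈u w / δ⌉₊) := by
      rw [← hmap]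
      exact (integral_map hm2.aemeasurable
        (hF.measurable.comp hm3).aestronglyMeasurable).symm
    rw [h1, integral_countable, tsum_eq_sum (s := S)]
    · refine Finset.sum_congr rfl fun j _ => ?_
      rw [Complex.real_smul]
      congr 2
      rw [measureReal_def, Measure.pi_singleton, ENNReal.toReal_prod]
      refine Finset.prod_congr rfl fun i _ => ?_
      rw [Measure.map_apply hr (measurableSet_singleton _)]
      rfl
    · intro j hj
      rw [hS j hj, smul_zero]
    · exact Integrable.of_bound (hF.measurable.comp hm3).aestronglyMeasurable C
        (Eventually.of_forall fun q => hC _)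
  rw [← e2, ← integral_sub i1 i2]
  have hp : ∀ᵐ q ∂(Measure.pi fun _ : Fin k => μ), ∀ i, 0 ≤ u (q i) := by
    rw [ae_all_iff]
    intro i
    exact (Measure.quasiMeasurePreserving_eval (μ := fun _ : Fin k => μ) i).ae hpos
  refine (norm_integral_le_of_norm_le_const (C := ε) ?_).trans_eq ?_
  · filter_upwards [hp] with q hq
    apply hε
    rw [dist_pi_le_iff hδ.le]
    intro i
    have h0 : 0 ≤ u (q i) / δ := div_nonneg (hq i) hδ.le
    have h1 := Nat.le_ceil (u (q i) / δ)
    have h2 := Nat.ceil_lt_add_one h0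
    rw [div_le_iff₀ hδ] at h1
    have h3 : (⌈u (q i) / δ⌉₊ : ℝ) * δ ≤ (u (q i) / δ + 1) * δ := by gcongr
    rw [add_mul, div_mul_cancel₀ _ hδ.ne'] at h3
    rw [Real.dist_eq, abs_le]
    constructor <;> nlinarith
  · rw [measureReal_def, Measure.pi_univ]
    simp [measureReal_def]

lemma aux_conv {k : ℕ} {Ω : Type*} [MeasurableSpace Ω] (μ : ℝ → Measure Ω)
    (hfin : ∀ x, IsFiniteMeasure (μ x))
    (u : ℝ → Ω → ℝ) (hu : ∀ x, Measurable (u x)) (hpos : ∀ᶠ x in atTop, ∀ w, 0 < u x w)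
    (B : ℝ) (hB : 0 < B)
    (hlim : ∀ a b, 0 ≤ a → a ≤ b → b ≤ B → 
      Tendsto (fun x => (μ x).real {w | a < u x w ∧ u x w ≤ b}) atTop (nhds (b - a)))
    (htot : ∀ᶠ x in atTop, (μ x).real Set.univ ≤ B + 1)
    (F : (Fin k → ℝ) → ℂ) (hF : Continuous F) (hcs : HasCompactSupport F)
    (h0 : ∀ t, (∃ i, t i ≤ 0) → F t = 0) (hB' : ∀ t, (∃ i, B < t i) → F t = 0) :
    Tendsto (fun x => ∫ q, F (fun i => u x (q i)) ∂(Measure.pi fun _ : Fin k => μ x)) atTop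
      (nhds (∫ t, F t ∂(Measure.pi fun _ : Fin k => volume.restrict (Set.Ioc 0 B)))) := by
  rw [Metric.tendsto_nhds]
  intro e he
  have hUC : UniformContinuous F := hcs.uniformContinuous_of_continuous hF
  set K : ℝ := (B + 1) ^ k with hK
  have hKpos : 0 < K := by positivity
  set ε : ℝ := e / (3 * K) with hεdef
  have hε : 0 < ε := by positivity
  have hεK : ε * K = e / 3 := by rw [hεdef]; field_simp
  obtain ⟨d, hd, hdF⟩ := Metric.uniformContinuous_iff.1 hUC ε hε
  obtain ⟨n, hn⟩ := exists_nat_gt (B / d)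
  have hn0 : (0:ℝ) < n := lt_trans (by positivity) hn
  set δ : ℝ := B / n with hδdef
  have hδ : 0 < δ := by positivity
  have hδd : δ < d := by
    rw [hδdef, div_lt_iff₀ hn0]
    rw [div_lt_iff₀ hd] at hn
    linarith
  have hnδ : n * δ = B := by rw [hδdef]; field_simp
  have hFε : ∀ s t, dist s t ≤ δ → ‖F s - F t‖ ≤ ε := fun s t h => by
    rw [← dist_eq_norm]; exact (hdF (lt_of_le_of_lt h hδd)).le
  let S : Finset (Fin k → ℕ) := Fintype.piFinset fun _ => Finset.Icc 1 n
  have hS : ∀ j : Fin k → ℕ, j ∉ S → F (fun i => δ * j i) = 0 := by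
    intro j hj
    simp only [S, Fintype.mem_piFinset, Finset.mem_Icc, not_forall] at hj
    obtain ⟨i, hi⟩ := hj
    by_cases h1 : 1 ≤ j i
    · apply hB'
      refine ⟨i, ?_⟩
      have : (n:ℝ) < j i := by exact_mod_cast (by omega : n < j i)
      rw [← hnδ]
      nlinarith
    · apply h0
      refine ⟨i, ?_⟩
      have : j i = 0 := by omega
      simp [this]
  have hset : ∀ m : ℕ, 1 ≤ m → ∀ v : ℝ, (⌈v / δ⌉₊ = m ↔ ((m:ℝ) - 1) * δ < v ∧ v ≤ m * δ) := by
    intro m hm v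
    rw [Nat.ceil_eq_iff (by omega), lt_div_iff₀ hδ, div_le_iff₀ hδ, Nat.cast_sub hm, Nat.cast_one]
  have hlebfin : IsFiniteMeasure (volume.restrict (Set.Ioc 0 B)) := ⟨by simp⟩
  have hleb : ∀ m ∈ Finset.Icc 1 n,
      (volume.restrict (Set.Ioc 0 B)).real {w : ℝ | ⌈w / δ⌉₊ = m} = δ := by
    intro m hm
    rw [Finset.mem_Icc] at hm
    have hm1 : (1:ℝ) ≤ m := by exact_mod_cast hm.1
    have hm2 : (m:ℝ) ≤ n := by exact_mod_cast hm.2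
    have : {w : ℝ | ⌈w / δ⌉₊ = m} = Set.Ioc (((m:ℝ) - 1) * δ) (m * δ) := by
      ext w; simp [hset m hm.1]
    rw [this, measureReal_restrict_apply measurableSet_Ioc, Set.inter_eq_left.2, 
      Real.volume_real_Ioc_of_le (by nlinarith)]
    · ring
    · apply Set.Ioc_subset_Ioc
      · apply mul_nonneg _ hδ.le; linarith
      · rw [← hnδ]; gcongr
  have hmu : ∀ m ∈ Finset.Icc 1 n,
      Tendsto (fun x => (μ x).real {w | ⌈u x w / δ⌉₊ = m}) atTop (nhds δ) := by
    intro m hm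
    rw [Finset.mem_Icc] at hm
    have hm1 : (1:ℝ) ≤ m := by exact_mod_cast hm.1
    have hm2 : (m:ℝ) ≤ n := by exact_mod_cast hm.2
    have := hlim (((m:ℝ) - 1) * δ) (m * δ) (mul_nonneg (by linarith) hδ.le) (by nlinarith)
      (by rw [← hnδ]; gcongr)
    simp only [hset m hm.1]
    convert this using 2
    ring
  have hsum : Tendsto (fun x => ∑ j ∈ S,
      ((∏ i, (μ x).real {w | ⌈u x w / δ⌉₊ = j i} : ℝ) : ℂ) * F (fun i => δ * j i)) atTop
      (nhds (∑ j ∈ S, ((∏ i, (volume.restrict (Set.Ioc 0 B)).real {w : ℝ | ⌈w / δ⌉₊ = j i} : ℝ) : ℂ)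
        * F (fun i => δ * j i))) := by
    refine tendsto_finsetSum _ fun j hj => ?_
    refine Tendsto.mul_const _ ?_
    refine (Complex.continuous_ofReal.tendsto _).comp ?_
    refine tendsto_finsetProd _ fun i _ => ?_
    have := Fintype.mem_piFinset.1 hj i
    rw [hleb _ this]
    exact hmu _ this
  have hL := aux_riemann (volume.restrict (Set.Ioc 0 B)) (fun t : ℝ => t) measurable_id
    (by filter_upwards [ae_restrict_mem measurableSet_Ioc] with w hw using hw.1.le)
    F hF hcs δ ε hδ hFε S hS
  have hLt : ε * (volume.restrict (Set.Ioc 0 B)).real Set.univ ^ k ≤ e / 3 := by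
    rw [← hεK, hK]
    gcongr
    simp [hB.le]
  filter_upwards [Metric.tendsto_nhds.1 hsum (e/3) (by positivity), htot, hpos] with x hx1 hx2 hx3
  have hX := aux_riemann (μ x) (u x) (hu x) (Eventually.of_forall fun w => (hx3 w).le)
    F hF hcs δ ε hδ hFε S hS
  have hXt : ε * (μ x).real Set.univ ^ k ≤ e / 3 := by
    rw [← hεK, hK]
    gcongr
  rw [← dist_eq_norm] at hX hL
  rw [dist_comm] at hL
  refine (dist_triangle4 _ _ _ _).trans_lt (lt_of_lt_of_eq (add_lt_add_of_lt_of_le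
    (add_lt_add_of_le_of_lt (hX.trans hXt) hx1) (hL.trans hLt)) (by ring))

lemma aux_T (f : ℕ → ℝ) (B b x : ℝ) (hx : 1 < x) (hb : b ≤ B) :
    ∑ p ∈ (Finset.Icc 1 ⌊x ^ b⌋₊).filter Nat.Prime, f p =
      ∑ p ∈ (Finset.Icc 1 ⌊x ^ B⌋₊).filter Nat.Prime,
        if Real.log p / Real.log x ≤ b then f p else 0 := by
  have hx0 : 0 < x := by linarith
  rw [← Finset.sum_filter]
  refine Finset.sum_congr ?_ fun _ _ => rfl
  ext p
  simp only [Finset.mem_filter, Finset.mem_Icc]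
  have hlog := Real.log_pos hx
  have key : ∀ c : ℝ, 1 ≤ p → (p ≤ ⌊x ^ c⌋₊ ↔ Real.log p / Real.log x ≤ c) := by
    intro c hp
    have hp0 : (0:ℝ) < p := by exact_mod_cast hp
    rw [Nat.le_floor_iff (Real.rpow_nonneg hx0.le _), div_le_iff₀ hlog,
      ← Real.log_rpow hx0, Real.log_le_log_iff hp0 (Real.rpow_pos_of_pos hx0 _)]
  constructor
  · rintro ⟨⟨h1, h2⟩, h3⟩
    rw [key _ h1] at h2
    exact ⟨⟨⟨h1, (key _ h1).2 (h2.trans hb)⟩, h3⟩, h2⟩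
  · rintro ⟨⟨⟨h1, h2⟩, h3⟩, h4⟩
    exact ⟨⟨h1, (key _ h1).2 h4⟩, h3⟩

instance instMeasPrimes : MeasurableSpace Nat.Primes := ⊤

instance instDiscPrimes : DiscreteMeasurableSpace Nat.Primes := ⟨fun _ => trivial⟩

noncomputable def auxS (B x : ℝ) : Finset Nat.Primes :=
  (Finset.Icc 1 ⌊x ^ B⌋₊).subtype Nat.Prime

lemma mem_auxS (B x : ℝ) (p : Nat.Primes) :
    p ∈ auxS B x ↔ (p : ℕ) ∈ Finset.Icc 1 ⌊x ^ B⌋₊ := Finset.mem_subtype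

noncomputable def auxMu (g : ℕ → ℝ) (B x : ℝ) : Measure Nat.Primes :=
  ∑ p ∈ auxS B x, ENNReal.ofReal (g p * Real.log p / Real.log x) • Measure.dirac p

instance auxMu_fin (g : ℕ → ℝ) (B x : ℝ) : IsFiniteMeasure (auxMu g B x) := by
  refine ⟨?_⟩
  simp [auxMu, ENNReal.sum_lt_top]

lemma auxMu_real (g : ℕ → ℝ) (hg : ∀ p : ℕ, p.Prime → 0 ≤ g p) (B x : ℝ) (hx : 1 < x)
    (A : Set Nat.Primes) : (auxMu g B x).real A =
      ∑ p ∈ auxS B x, if p ∈ A then g p * Real.log p / Real.log x else 0 := by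
  have hlog := Real.log_pos hx
  rw [measureReal_def, auxMu, Measure.finsetSum_apply, ENNReal.toReal_sum]
  · refine Finset.sum_congr rfl fun p _ => ?_
    have hw : 0 ≤ g p * Real.log p / Real.log x :=
      div_nonneg (mul_nonneg (hg _ p.2) (Real.log_natCast_nonneg _)) hlog.le
    rw [Measure.smul_apply, Measure.dirac_apply' _ (MeasurableSet.of_discrete)]
    by_cases h : p ∈ A <;> simp [h, hw]
  · intro p _
    rw [Measure.smul_apply, Measure.dirac_apply' _ (MeasurableSet.of_discrete)]
    by_cases h : p ∈ A <;> simp [h]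

lemma auxMu_Ioc (g : ℕ → ℝ) (hg : ∀ p : ℕ, p.Prime → 0 ≤ g p) (B x : ℝ) (hx : 1 < x)
    (a b : ℝ) (hab : a ≤ b) (hb : b ≤ B) :
    (auxMu g B x).real {p | a < Real.log (p : ℕ) / Real.log x ∧ Real.log (p : ℕ) / Real.log x ≤ b} =
    ((∑ p ∈ (Finset.Icc 1 ⌊x ^ b⌋₊).filter Nat.Prime, g p * Real.log p) -
      (∑ p ∈ (Finset.Icc 1 ⌊x ^ a⌋₊).filter Nat.Prime, g p * Real.log p)) / Real.log x := by
  rw [auxMu_real g hg B x hx, aux_T _ B b x hx hb, aux_T _ B a x hx (hab.trans hb),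
    ← Finset.sum_sub_distrib, Finset.sum_div, auxS]
  rw [← Finset.sum_subtype_eq_sum_filter]
  refine Finset.sum_congr rfl fun p _ => ?_
  simp only [Set.mem_ofPred_eq]
  by_cases h1 : Real.log (p : ℕ) / Real.log x ≤ a
  · simp [h1, h1.trans hab, not_lt.2 h1]
  · by_cases h2 : Real.log (p : ℕ) / Real.log x ≤ b
    · simp [h1, h2, not_le.1 h1]
    · simp [h1, h2]

lemma aux_lim (g : ℕ → ℝ) (hg : ∀ p : ℕ, p.Prime → 0 ≤ g p)
    (hM : ∃ M : ℝ, ∀ x : ℝ, 2 ≤ x →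
      |(∑ p ∈ (Finset.Icc 1 ⌊x⌋₊).filter Nat.Prime, g p * Real.log p) - Real.log x| ≤ M)
    (B a b : ℝ) (ha : 0 ≤ a) (hab : a ≤ b) (hb : b ≤ B) :
    Tendsto (fun x => (auxMu g B x).real {p | a < Real.log (p : ℕ) / Real.log x ∧
      Real.log (p : ℕ) / Real.log x ≤ b}) atTop (nhds (b - a)) := by
  obtain ⟨M, hM⟩ := hM
  have hM' : ∀ y : ℝ, 1 ≤ y →
      |(∑ p ∈ (Finset.Icc 1 ⌊y⌋₊).filter Nat.Prime, g p * Real.log p) - Real.log y| ≤ 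
        max M (Real.log 2) := by
    intro y hy
    rcases le_or_gt 2 y with h | h
    · exact (hM y h).trans (le_max_left _ _)
    · have hfl : ⌊y⌋₊ = 1 := by
        rw [Nat.floor_eq_iff (by linarith)]
        constructor
        · simpa using hy
        · norm_num; exact h
      have : (Finset.Icc 1 1).filter Nat.Prime = ∅ := by decide
      rw [hfl, Finset.sum_eq_zero, zero_sub, abs_neg, abs_of_nonneg (Real.log_nonneg hy)]
      · exact (Real.log_le_log (by linarith) h.le).trans (le_max_right _ _)
      · intro p hp
        simp only [Finset.mem_filter, Finset.mem_Icc] at hp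
        have : p = 1 := by omega
        simp [this]
  set L := max M (Real.log 2)
  rw [tendsto_iff_norm_sub_tendsto_zero]
  have hz : Tendsto (fun x : ℝ => 2 * L / Real.log x) atTop (nhds 0) :=
    tendsto_const_nhds.div_atTop Real.tendsto_log_atTop
  refine squeeze_zero' (Eventually.of_forall fun _ => norm_nonneg _) ?_ hz
  filter_upwards [eventually_gt_atTop 1] with x hx
  have hlog := Real.log_pos hx
  have hx0 : 0 < x := by linarith
  rw [auxMu_Ioc g hg B x hx a b hab hb]
  have h1 := hM' (x ^ a) (Real.one_le_rpow hx.le ha)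
  have h2 := hM' (x ^ b) (Real.one_le_rpow hx.le (ha.trans hab))
  rw [Real.log_rpow hx0] at h1 h2
  rw [Real.norm_eq_abs, le_div_iff₀ hlog, ← abs_of_pos hlog, ← abs_mul, abs_of_pos hlog, sub_mul,
    div_mul_cancel₀ _ hlog.ne']
  rw [abs_le] at *
  constructor <;> linarith [h1.1, h1.2, h2.1, h2.2]

theorem prime_sum_correlation (g : ℕ → ℝ) (hg : ∀ p : ℕ, p.Prime → 0 ≤ g p)
    (hM : ∃ M : ℝ, ∀ x : ℝ, 2 ≤ x →
      |(∑ p ∈ (Finset.Icc 1 ⌊x⌋₊).filter Nat.Prime, g p * Real.log p) - Real.log x| ≤ M)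
    (k : ℕ) (hk : 1 ≤ k) (η : (Fin k → ℝ) → ℂ) (hη : Continuous η)
    (hcs : HasCompactSupport η)
    (hsupp : tsupport η ⊆ Set.univ.pi fun _ => Set.Ioi (0:ℝ)) :
    Tendsto (fun x : ℝ => ∑' q : Fin k → Nat.Primes,
        ((∏ i, g ((q i : ℕ))) : ℂ) * η (fun i => Real.log ((q i : ℕ) : ℝ) / Real.log x))
      atTop
      (nhds (∫ t in Set.univ.pi fun _ : Fin k => Set.Ioi (0:ℝ), η t / ∏ i, (t i : ℂ))) := by
  obtain ⟨B, hB, hBη⟩ : ∃ B : ℝ, 0 < B ∧ ∀ t, (∃ i, B < t i) → η t = 0 := by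
    obtain ⟨R, hR⟩ := hcs.isCompact.isBounded.subset_closedBall 0
    refine ⟨max R 1, by positivity, fun t ⟨i, hi⟩ => ?_⟩
    by_contra h
    have h1 := hR (subset_tsupport _ h)
    rw [mem_closedBall_zero_iff] at h1
    have h2 := norm_le_pi_norm t i
    have h3 := le_abs_self (t i)
    rw [Real.norm_eq_abs] at h2
    linarith [le_max_left R 1]
  have h0η : ∀ t, (∃ i, t i ≤ 0) → η t = 0 := by
    rintro t ⟨i, hi⟩
    by_contra h
    exact absurd (hsupp (subset_tsupport _ h) i (Set.mem_univ _)) (not_lt.2 hi)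
  set F : (Fin k → ℝ) → ℂ := fun t => η t / ∏ i, (t i : ℂ) with hFdef
  have hF0 : ∀ t, η t = 0 → F t = 0 := fun t h => by simp [hFdef, h]
  have hFsub : tsupport F ⊆ tsupport η := 
    closure_mono fun t ht h => ht (hF0 t h)
  have hFcs : HasCompactSupport F := hcs.mono' ((subset_tsupport F).trans hFsub)
  have hF : Continuous F := by
    refine continuous_of_tsupport fun t ht => ?_
    have hpos := hsupp (hFsub ht)
    refine hη.continuousAt.div (Continuous.continuousAt (continuous_finsetProd _ fun i _ =>
      Complex.continuous_ofReal.comp (continuous_apply i))) ?_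
    rw [Finset.prod_ne_zero_iff]
    intro i _
    exact_mod_cast (hpos i (Set.mem_univ _)).ne'
  have main := aux_conv (auxMu g B) (fun x => auxMu_fin g B x)
    (fun x p => Real.log (p : ℕ) / Real.log x) (fun x => Measurable.of_discrete)
    (by
      filter_upwards [eventually_gt_atTop 1] with x hx p
      exact div_pos (Real.log_pos (by exact_mod_cast p.2.one_lt)) (Real.log_pos hx))
    B hB (fun a b ha hab hb => aux_lim g hg hM B a b ha hab hb)
    (by
      have h := aux_lim g hg hM B 0 B le_rfl hB.le le_rfl
      filter_upwards [h.eventually_lt_const (show B - 0 < B + 1 by linarith),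
        eventually_gt_atTop 1] with x hx hx1
      refine le_trans (le_of_eq ?_) hx.le
      rw [auxMu_real g hg B x hx1, auxMu_real g hg B x hx1]
      refine Finset.sum_congr rfl fun p hp => ?_
      have hx0 : 0 < x := by linarith
      have hp0 : (0:ℝ) < (p : ℕ) := by exact_mod_cast p.2.pos
      have hp1 : 0 < Real.log (p : ℕ) / Real.log x :=
        div_pos (Real.log_pos (by exact_mod_cast p.2.one_lt)) (Real.log_pos hx1)
      have hp2 : Real.log (p : ℕ) / Real.log x ≤ B := by
        rw [mem_auxS, Finset.mem_Icc,
          Nat.le_floor_iff (Real.rpow_nonneg hx0.le _)] at hp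
        rw [div_le_iff₀ (Real.log_pos hx1), ← Real.log_rpow hx0]
        exact Real.log_le_log hp0 hp.2
      simp only [Set.mem_univ, Set.mem_ofPred_eq, hp1, hp2, and_self])
    F hF hFcs (fun t h => hF0 t (h0η t h)) (fun t h => hF0 t (hBη t h))
  have hint : (∫ t in Set.univ.pi fun _ : Fin k => Set.Ioi (0:ℝ), η t / ∏ i, (t i : ℂ)) =
      ∫ t, F t ∂(Measure.pi fun _ : Fin k => volume.restrict (Set.Ioc 0 B)) := by
    rw [← Measure.restrict_pi_pi, ← volume_pi]
    refine setIntegral_eq_of_subset_of_forall_sdiff_eq_zero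
      (MeasurableSet.univ_pi fun _ => measurableSet_Ioi)
      (Set.pi_mono fun _ _ => Set.Ioc_subset_Ioi_self) ?_
    rintro t ⟨ht1, ht2⟩
    apply hF0
    apply hBη
    simp only [Set.mem_pi, Set.mem_univ, true_implies, not_forall] at ht1 ht2
    obtain ⟨i, hi⟩ := ht2
    refine ⟨i, ?_⟩
    by_contra h
    exact hi ⟨ht1 i, not_lt.1 h⟩
  rw [hint]
  refine main.congr' ?_
  filter_upwards [eventually_gt_atTop 1] with x hx
  obtain ⟨C, hC⟩ := hFcs.exists_bound_of_continuous hF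
  have hx0 : 0 < x := by linarith
  have hlog := Real.log_pos hx
  have hmeas : Measurable (fun q : Fin k → Nat.Primes => 
      (fun i => Real.log ((q i : ℕ) : ℝ) / Real.log x)) :=
    measurable_pi_lambda _ fun i => 
      (Measurable.of_discrete (f := fun p : Nat.Primes => Real.log ((p : ℕ) : ℝ) / Real.log x)).comp
        (measurable_pi_apply i)
  have : Countable Nat.Primes := inferInstance
  rw [integral_countable]
  · refine tsum_congr fun q => ?_
    by_cases hq : ∀ i, q i ∈ auxS B x
    · have h1 : (Measure.pi fun _ : Fin k => auxMu g B x).real {q} = 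
          ∏ i, (g (q i : ℕ) * (Real.log ((q i : ℕ) : ℝ) / Real.log x)) := by
        rw [measureReal_def, Measure.pi_singleton, ENNReal.toReal_prod]
        refine Finset.prod_congr rfl fun i _ => ?_
        have := auxMu_real g hg B x hx {q i}
        rw [measureReal_def] at this
        rw [this]
        simp only [Set.mem_singleton_iff]
        rw [Finset.sum_ite_eq' , if_pos (hq i), mul_div_assoc]
      rw [h1, Complex.real_smul, hFdef, Finset.prod_mul_distrib]
      have h2 : (∏ i, ((Real.log ((q i : ℕ) : ℝ) / Real.log x : ℝ) : ℂ)) ≠ 0 := by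
        rw [Finset.prod_ne_zero_iff]
        intro i _
        have : 0 < Real.log ((q i : ℕ) : ℝ) / Real.log x :=
          div_pos (Real.log_pos (by exact_mod_cast (q i).2.one_lt)) hlog
        exact_mod_cast this.ne'
      rw [Complex.ofReal_mul, Complex.ofReal_prod, Complex.ofReal_prod]
      dsimp only
      rw [mul_assoc, mul_div_cancel₀ _ h2]
    · push Not at hq
      obtain ⟨i, hi⟩ := hq
      have hz : η (fun i => Real.log ((q i : ℕ) : ℝ) / Real.log x) = 0 := by
        apply hBη
        refine ⟨i, ?_⟩
        rw [mem_auxS, Finset.mem_Icc,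
          Nat.le_floor_iff (Real.rpow_nonneg hx0.le _), not_and] at hi
        have hi := not_le.1 (hi (q i).2.one_lt.le)
        rw [lt_div_iff₀ hlog, ← Real.log_rpow hx0]
        exact Real.log_lt_log (Real.rpow_pos_of_pos hx0 _) hi
      rw [hF0 _ hz, hz, smul_zero, mul_zero]
  · exact Integrable.of_bound (hF.measurable.comp hmeas).aestronglyMeasurable C
      (Eventually.of_forall fun q => hC _)
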